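/- arXiv:1901.10000 — 2 statements merged into one kernel-verified Lean document; each statement's English description precedes it below -/
import Mathlib

section
/- Let z be a feasible point that is a global minimizer of f over the feasible set (i.e., f(z) ≤ f(y) for every feasible y). Let (ρ_k) be positive reals with ρ_k → ∞, let (ε_k) be nonnegative reals with ε_k → 0, let (λ^k) be a sequence in ℝ^n with 0 ≤ λ^k_i ≤ Λ_i for all k and i, and let (γ^k) be a sequence in ℝ^m with |γ^k_j| ≤ Γ_j for all k and j. Suppose the sequence (x_k) in E satisfies, for every k, L_{ρ_k}(x_{k+1}, λ^k, γ^k) ≤ L_{ρ_k}(z, λ^k, γ^k) + ε_k. If x̄ ∈ E is a limit point of (x_k) (i.e., some subsequence of (x_k) converges to x̄), then x̄ is feasible and f(x̄) ≤ f(y) for every feasible y. -/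
open Filter Topology

/-- A bounded sequence divided by a sequence tending to infinity tends to zero. -/
lemma tendsto_div_zero_of_abs_le {u ρ : ℕ → ℝ} {C : ℝ} (hu : ∀ k, |u k| ≤ C)
    (hρ : Tendsto ρ atTop atTop) : Tendsto (fun k => u k / ρ k) atTop (𝓝 0) := by
  simp only [div_eq_mul_inv]
  exact bdd_le_mul_tendsto_zero' C (Eventually.of_forall hu) hρ.inv_tendsto_atTop

theorem stmt_0
    {E : Type*} [NormedAddCommGroup E] [InnerProductSpace ℝ E] [FiniteDimensional ℝ E]
    {n m : ℕ} (f : E → ℝ) (g : Fin n → E → ℝ) (h : Fin m → E → ℝ)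
    (hf : ContDiff ℝ 2 f) (hg : ∀ i, ContDiff ℝ 2 (g i)) (hh : ∀ j, ContDiff ℝ 2 (h j))
    (L : ℝ → (Fin n → ℝ) → (Fin m → ℝ) → E → ℝ)
    (hL : ∀ ρ lam gam x, L ρ lam gam x =
      f x + ρ / 2 * ((∑ j, (h j x + gam j / ρ) ^ 2) + ∑ i, (max 0 (lam i / ρ + g i x)) ^ 2))
    (feasible : E → Prop)
    (hfeas : ∀ x, feasible x ↔ (∀ i, g i x ≤ 0) ∧ ∀ j, h j x = 0)
    (z : E) (hz : feasible z) (hzmin : ∀ y, feasible y → f z ≤ f y)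
    (ρ : ℕ → ℝ) (hρpos : ∀ k, 0 < ρ k) (hρ : Tendsto ρ atTop atTop)
    (ε : ℕ → ℝ) (hεnn : ∀ k, 0 ≤ ε k) (hε : Tendsto ε atTop (𝓝 0))
    (lam : ℕ → Fin n → ℝ) (Λ : Fin n → ℝ)
    (hlam : ∀ k i, 0 ≤ lam k i ∧ lam k i ≤ Λ i)
    (gam : ℕ → Fin m → ℝ) (Γ : Fin m → ℝ) (hgam : ∀ k j, |gam k j| ≤ Γ j)
    (x : ℕ → E)
    (hx : ∀ k, L (ρ k) (lam k) (gam k) (x (k + 1)) ≤ L (ρ k) (lam k) (gam k) z + ε k)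
    (xbar : E) (φ : ℕ → ℕ) (hφ : StrictMono φ)
    (hlim : Tendsto (x ∘ φ) atTop (𝓝 xbar)) :
    feasible xbar ∧ ∀ y, feasible y → f xbar ≤ f y := by
  have hfc := hf.continuous
  have hgc : ∀ i, Continuous (g i) := fun i => (hg i).continuous
  have hhc : ∀ j, Continuous (h j) := fun j => (hh j).continuous
  set κ : ℕ → ℕ := fun t => φ (t + 1) - 1
  have hκφ : ∀ t, κ t + 1 = φ (t + 1) := fun t =>
    Nat.sub_add_cancel ((Nat.le_add_left 1 t).trans (hφ.le_apply))
  have hκ : Tendsto κ atTop atTop :=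
    tendsto_atTop_mono (fun t => Nat.le_sub_one_of_lt (hφ.le_apply (x := t + 1))) tendsto_id
  have hy : Tendsto (fun t => x (κ t + 1)) atTop (𝓝 xbar) := by
    simp only [hκφ]
    exact hlim.comp (tendsto_add_atTop_nat 1)
  have hρκ := hρ.comp hκ
  have hlam0 : ∀ i, Tendsto (fun t => lam (κ t) i / ρ (κ t)) atTop (𝓝 0) := fun i =>
    (tendsto_div_zero_of_abs_le (u := fun k => lam k i) (C := Λ i)
      (fun k => by rw [abs_of_nonneg (hlam k i).1]; exact (hlam k i).2) hρ).comp hκ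
  have hgam0 : ∀ j, Tendsto (fun t => gam (κ t) j / ρ (κ t)) atTop (𝓝 0) := fun j =>
    (tendsto_div_zero_of_abs_le (u := fun k => gam k j) (fun k => hgam k j) hρ).comp hκ
  set S : ℕ → E → ℝ := fun k p =>
    (∑ j, (h j p + gam k j / ρ k) ^ 2) + ∑ i, (max 0 (lam k i / ρ k + g i p)) ^ 2
  have hS0 : ∀ k p, 0 ≤ S k p := fun k p => by positivity
  have hSlim : Tendsto (fun t => S (κ t) (x (κ t + 1))) atTop
      (𝓝 ((∑ j, h j xbar ^ 2) + ∑ i, (max 0 (g i xbar)) ^ 2)) := by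
    refine Tendsto.add (tendsto_finsetSum _ fun j _ => ?_) (tendsto_finsetSum _ fun i _ => ?_)
    · simpa using ((((hhc j).tendsto xbar).comp hy).add (hgam0 j)).pow 2
    · simpa using
        ((tendsto_const_nhds (x := (0 : ℝ))).max
          ((hlam0 i).add (((hgc i).tendsto xbar).comp hy))).pow 2
  obtain ⟨hzg, hzh⟩ := (hfeas z).1 hz
  set C : ℝ := (∑ j, Γ j ^ 2) + ∑ i, Λ i ^ 2
  have hSz : ∀ k, ρ k / 2 * S k z ≤ C / 2 / ρ k := fun k => by
    have hk := hρpos k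
    have hle : S k z ≤ C / ρ k ^ 2 := by
      simp only [S, C, add_div, Finset.sum_div]
      refine add_le_add (Finset.sum_le_sum fun j _ => ?_) (Finset.sum_le_sum fun i _ => ?_)
      · rw [hzh j, zero_add, div_pow, ← sq_abs (gam k j)]
        gcongr
        exact hgam k j
      · rw [← div_pow]
        obtain ⟨h0, h1⟩ := hlam k i
        refine pow_le_pow_left₀ (le_max_left _ _) (max_le (div_nonneg (h0.trans h1) hk.le) ?_) 2
        have : lam k i / ρ k ≤ Λ i / ρ k := by gcongr
        linarith [hzg i]
    calc ρ k / 2 * S k z ≤ ρ k / 2 * (C / ρ k ^ 2) := by gcongr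
      _ = C / 2 / ρ k := by field_simp
  have key : ∀ k, f (x (k + 1)) + ρ k / 2 * S k (x (k + 1)) ≤ f z + C / 2 / ρ k + ε k := fun k => by
    have := hx k
    simp only [hL] at this
    linarith [hSz k]
  have hfy : Tendsto (fun t => f (x (κ t + 1))) atTop (𝓝 (f xbar)) := (hfc.tendsto xbar).comp hy
  have hrhs : Tendsto (fun t => f z + C / 2 / ρ (κ t) + ε (κ t)) atTop (𝓝 (f z)) := by
    simpa using (tendsto_const_nhds.add (hρκ.const_div_atTop (C / 2))).add (hε.comp hκ)
  have hfle : f xbar ≤ f z := le_of_tendsto_of_tendsto' hfy hrhs fun t => by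
    have := mul_nonneg (half_pos (hρpos (κ t))).le (hS0 (κ t) (x (κ t + 1)))
    linarith [key (κ t)]
  have hSle : (∑ j, h j xbar ^ 2) + ∑ i, (max 0 (g i xbar)) ^ 2 ≤ 0 := by
    refine le_of_tendsto_of_tendsto' hSlim
      ((hrhs.sub hfy).div_atTop (hρκ.atTop_div_const two_pos)) fun t => ?_
    refine (le_div_iff₀ (half_pos (hρpos (κ t)))).2 ?_
    linarith [key (κ t), mul_comm (ρ (κ t) / 2) (S (κ t) (x (κ t + 1)))]
  have hh0 : 0 ≤ ∑ j, h j xbar ^ 2 := by positivity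
  have hg0 : 0 ≤ ∑ i, (max 0 (g i xbar)) ^ 2 := by positivity
  refine ⟨(hfeas xbar).2 ⟨fun i => ?_, fun j => ?_⟩, fun y hy => hfle.trans (hzmin y hy)⟩
  · have := (Finset.sum_eq_zero_iff_of_nonneg fun i _ => sq_nonneg (max 0 (g i xbar))).1
      (by linarith) i (Finset.mem_univ i)
    exact max_eq_left_iff.1 (pow_eq_zero_iff two_ne_zero |>.1 this)
  · have := (Finset.sum_eq_zero_iff_of_nonneg fun j _ => sq_nonneg (h j xbar)).1
      (by linarith) j (Finset.mem_univ j)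
    exact pow_eq_zero_iff two_ne_zero |>.1 this
end

section
/- Let (ρ_k) be positive reals, (ε_k) nonnegative reals with ε_k → 0, and let (x_k) in E, (λ^k) in ℝ^n, (γ^k) in ℝ^m satisfy: (i) for every k, the gradient of x ↦ L_{ρ_k}(x, λ^k, γ^k) at x_{k+1} has norm at most ε_k; (ii) for every k and i, 0 ≤ λ^0_i ≤ Λ_i and λ^{k+1}_i = clip_{[0, Λ_i]}(λ^k_i + ρ_k g_i(x_{k+1})), and for every k and j, a_j ≤ γ^0_j ≤ b_j and γ^{k+1}_j = clip_{[a_j, b_j]}(γ^k_j + ρ_k h_j(x_{k+1})); (iii) either ρ_k → ∞, or for every i, max{g_i(x_{k+1}), −λ^k_i/ρ_k} → 0 as k → ∞; (iv) x_k → x̄, where x̄ is feasible and LICQ holds at x̄. Then x̄ satisfies the KKT conditions. -/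
open Filter Topology

/-- If the matrices `M k` converge to the identity and `M k *ᵥ c k` converges to `w`, then so does
`c k`. -/
theorem Matrix.tendsto_of_tendsto_mulVec {ι α : Type*} [Fintype ι] [DecidableEq ι] {l : Filter α}
    {M : α → Matrix ι ι ℝ} (hM : Tendsto M l (𝓝 1)) {c : α → ι → ℝ} {w : ι → ℝ}
    (hw : Tendsto (fun k => (M k).mulVec (c k)) l (𝓝 w)) : Tendsto c l (𝓝 w) := by
  have hdet : Tendsto (fun k => (M k).det) l (𝓝 1) := by
    have hcont : Continuous fun A : Matrix ι ι ℝ => A.det := continuous_id.matrix_det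
    simpa only [Function.comp_def, Matrix.det_one] using (hcont.tendsto 1).comp hM
  have hadj : Tendsto (fun k => (M k).adjugate) l (𝓝 1) := by
    have hcont : Continuous fun A : Matrix ι ι ℝ => A.adjugate := continuous_id.matrix_adjugate
    simpa only [Function.comp_def, Matrix.adjugate_one] using (hcont.tendsto 1).comp hM
  have hprod : Tendsto (fun k => (M k).adjugate.mulVec ((M k).mulVec (c k))) l (𝓝 w) := by
    have hcont : Continuous fun p : Matrix ι ι ℝ × (ι → ℝ) => p.1.mulVec p.2 :=
      continuous_fst.matrix_mulVec continuous_snd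
    simpa only [Function.comp_def, Matrix.one_mulVec] using
      (hcont.tendsto (1, w)).comp (hadj.prodMk_nhds hw)
  have hlim := (hdet.inv₀ one_ne_zero).smul hprod
  rw [inv_one, one_smul] at hlim
  refine hlim.congr' ?_
  filter_upwards [hdet.eventually_ne one_ne_zero] with k hk
  rw [Matrix.mulVec_mulVec, Matrix.adjugate_mul, Matrix.smul_mulVec, Matrix.one_mulVec,
    inv_smul_smul₀ hk]

/-- If the vectors `V k i` converge to a linearly independent family `v` and the linear combinations
`∑ i, c k i • V k i` converge to `w`, then the coefficients converge, and their limits represent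
`w` in terms of `v`. -/
theorem LinearIndependent.exists_tendsto_coeff
    {E : Type*} [NormedAddCommGroup E] [NormedSpace ℝ E] [FiniteDimensional ℝ E]
    {ι α : Type*} [Fintype ι] {l : Filter α} [l.NeBot] {v : ι → E} (hv : LinearIndependent ℝ v)
    {V : α → ι → E} (hV : ∀ i, Tendsto (fun k => V k i) l (𝓝 (v i)))
    {c : α → ι → ℝ} {w : E} (hw : Tendsto (fun k => ∑ i, c k i • V k i) l (𝓝 w)) :
    ∃ c' : ι → ℝ, (∀ i, Tendsto (fun k => c k i) l (𝓝 (c' i))) ∧ ∑ i, c' i • v i = w := by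
  classical
  obtain ⟨B, hB⟩ := (Fintype.linearCombination ℝ v).exists_leftInverse_of_injective
    (LinearMap.ker_eq_bot.2 hv.fintypeLinearCombination_injective)
  have hBv : ∀ i, B (v i) = Pi.single i 1 := fun i => by
    simpa [Fintype.linearCombination_apply_single] using LinearMap.congr_fun hB (Pi.single i 1)
  have hBc : Continuous B := B.continuous_of_finiteDimensional
  let M : α → Matrix ι ι ℝ := fun k => Matrix.of fun i j => B (V k j) i
  have hM : Tendsto M l (𝓝 1) := by
    refine tendsto_pi_nhds.2 fun i => tendsto_pi_nhds.2 fun j => ?_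
    have h1 := ((continuous_apply i).comp hBc).continuousAt.tendsto.comp (hV j)
    simpa [Function.comp_def, hBv, Matrix.one_apply, Pi.single_apply, M] using h1
  have hMc : ∀ k, (M k).mulVec (c k) = B (∑ i, c k i • V k i) := fun k => by
    ext i
    simp [M, Matrix.mulVec, dotProduct, mul_comm]
  have hc : Tendsto c l (𝓝 (B w)) := by
    refine Matrix.tendsto_of_tendsto_mulVec hM ?_
    simp only [hMc]
    exact (hBc.tendsto w).comp hw
  refine ⟨B w, tendsto_pi_nhds.1 hc, tendsto_nhds_unique ?_ hw⟩
  exact tendsto_finsetSum _ fun i _ => (tendsto_pi_nhds.1 hc i).smul (hV i)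

theorem hasDerivAt_max_zero_sq (t : ℝ) :
    HasDerivAt (fun s : ℝ => (max 0 s) ^ 2) (2 * max 0 t) t := by
  rcases lt_trichotomy t 0 with ht | rfl | ht
  · rw [max_eq_left ht.le, mul_zero]
    refine (hasDerivAt_const t (0 : ℝ)).congr_of_eventuallyEq ?_
    filter_upwards [eventually_lt_nhds ht] with s hs
    simp [max_eq_left hs.le]
  · rw [max_self, mul_zero]
    refine HasFDerivAt.hasDerivAt (f' := 0) ?_ |>.congr_deriv (by simp)
    refine .of_isLittleO ?_
    have : (fun s : ℝ => s ^ 2) =o[𝓝 0] fun s : ℝ => s := by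
      simpa using Asymptotics.isLittleO_pow_pow (𝕜 := ℝ) (one_lt_two)
    refine Asymptotics.IsBigO.trans_isLittleO (.of_bound 1 (.of_forall fun s => ?_))
      (by simpa using this)
    rcases le_total 0 s with hs | hs <;> simp [hs, sq_nonneg]
  · rw [max_eq_right ht.le]
    refine HasDerivAt.congr_of_eventuallyEq (by simpa using hasDerivAt_pow 2 t) ?_
    filter_upwards [eventually_gt_nhds ht] with s hs
    simp [max_eq_right hs.le]

theorem ContDiff.continuous_gradient {E : Type*} [NormedAddCommGroup E] [InnerProductSpace ℝ E]
    [CompleteSpace E] {f : E → ℝ} {r : WithTop ℕ∞} (hf : ContDiff ℝ r f) (hr : r ≠ 0) :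
    Continuous (gradient f) :=
  (InnerProductSpace.toDual ℝ E).symm.continuous.comp (hf.continuous_fderiv hr)

theorem gradient_augmentedLagrangian
    {E : Type*} [NormedAddCommGroup E] [InnerProductSpace ℝ E] [CompleteSpace E]
    {ι κ : Type*} [Fintype ι] [Fintype κ] {f : E → ℝ} {g : ι → E → ℝ} {h : κ → E → ℝ} {x : E}
    (hf : DifferentiableAt ℝ f x) (hg : ∀ i, DifferentiableAt ℝ (g i) x)
    (hh : ∀ j, DifferentiableAt ℝ (h j) x)
    (ρ : ℝ) (lam : ι → ℝ) (gam : κ → ℝ) :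
    gradient (fun x => f x + ρ / 2 *
      ((∑ j, (h j x + gam j / ρ) ^ 2) + ∑ i, (max 0 (lam i / ρ + g i x)) ^ 2)) x =
      gradient f x + (∑ i, (ρ * max 0 (lam i / ρ + g i x)) • gradient (g i) x)
        + ∑ j, (ρ * (h j x + gam j / ρ)) • gradient (h j) x := by
  have hsq : ∀ j, HasFDerivAt (fun x => (h j x + gam j / ρ) ^ 2)
      ((2 * (h j x + gam j / ρ)) • fderiv ℝ (h j) x) x := fun j => by
    simpa only [Nat.add_one_sub_one, pow_one, nsmul_eq_mul, Nat.cast_ofNat] using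
      ((hh j).hasFDerivAt.add_const (gam j / ρ)).pow 2
  have hmax : ∀ i, HasFDerivAt (fun x => (max 0 (lam i / ρ + g i x)) ^ 2)
      ((2 * max 0 (lam i / ρ + g i x)) • fderiv ℝ (g i) x) x := fun i =>
    (hasDerivAt_max_zero_sq _).comp_hasFDerivAt x ((hg i).hasFDerivAt.const_add _)
  have key := hf.hasFDerivAt.fun_add (((HasFDerivAt.fun_sum fun j (_ : j ∈ Finset.univ) => hsq j).fun_add
    (HasFDerivAt.fun_sum fun i (_ : i ∈ Finset.univ) => hmax i)).const_mul (ρ / 2))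
  unfold gradient
  rw [key.fderiv]
  have : ∀ s : ℝ, ρ / 2 * (2 * s) = ρ * s := fun s => by ring
  simp only [map_add, smul_add, Finset.smul_sum, map_sum, smul_smul, this,
    map_smulₛₗ, conj_trivial]
  abel

theorem stmt_1
    {E : Type*} [NormedAddCommGroup E] [InnerProductSpace ℝ E] [FiniteDimensional ℝ E]
    {n m : ℕ} (f : E → ℝ) (g : Fin n → E → ℝ) (h : Fin m → E → ℝ)
    (hf : ContDiff ℝ 2 f) (hg : ∀ i, ContDiff ℝ 2 (g i)) (hh : ∀ j, ContDiff ℝ 2 (h j))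
    (L : ℝ → (Fin n → ℝ) → (Fin m → ℝ) → E → ℝ)
    (hL : ∀ ρ lam gam x, L ρ lam gam x =
      f x + ρ / 2 * ((∑ j, (h j x + gam j / ρ) ^ 2) + ∑ i, (max 0 (lam i / ρ + g i x)) ^ 2))
    (ρ : ℕ → ℝ) (hρpos : ∀ k, 0 < ρ k)
    (ε : ℕ → ℝ) (hεnn : ∀ k, 0 ≤ ε k) (hε : Tendsto ε atTop (𝓝 0))
    (x : ℕ → E) (lam : ℕ → Fin n → ℝ) (gam : ℕ → Fin m → ℝ)
    -- (i) approximate first-order stationarity of the subsolver iterates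
    (hgrad : ∀ k, ‖gradient (L (ρ k) (lam k) (gam k)) (x (k + 1))‖ ≤ ε k)
    -- (ii) clipped multiplier updates with safeguards
    (Λ : Fin n → ℝ) (hlam0 : ∀ i, 0 ≤ lam 0 i ∧ lam 0 i ≤ Λ i)
    (hlamupd : ∀ k i, lam (k + 1) i = max 0 (min (Λ i) (lam k i + ρ k * g i (x (k + 1)))))
    (a b : Fin m → ℝ) (hgam0 : ∀ j, a j ≤ gam 0 j ∧ gam 0 j ≤ b j)
    (hgamupd : ∀ k j, gam (k + 1) j = max (a j) (min (b j) (gam k j + ρ k * h j (x (k + 1)))))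
    -- (iii) either the penalty parameters blow up, or constraint violations vanish
    (halt : Tendsto ρ atTop atTop ∨
      ∀ i, Tendsto (fun k => max (g i (x (k + 1))) (-(lam k i) / ρ k)) atTop (𝓝 0))
    -- (iv) convergence to a feasible point where LICQ holds
    (xbar : E) (hx : Tendsto x atTop (𝓝 xbar))
    (hxbarfeas : (∀ i, g i xbar ≤ 0) ∧ ∀ j, h j xbar = 0)
    (hLICQ : LinearIndependent ℝ
      (Sum.elim (fun i : {i : Fin n // g i xbar = 0} => gradient (g i.1) xbar)
        (fun j : Fin m => gradient (h j) xbar))) :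
    -- conclusion: KKT conditions hold at xbar
    ∃ (lams : Fin n → ℝ) (gams : Fin m → ℝ),
      (∀ i, 0 ≤ lams i) ∧ (∀ i, lams i * g i xbar = 0) ∧
      gradient f xbar + (∑ i, lams i • gradient (g i) xbar)
        + (∑ j, gams j • gradient (h j) xbar) = 0 := by
  classical
  have hlam : ∀ k i, 0 ≤ lam k i ∧ lam k i ≤ Λ i := by
    rintro (_ | k) i
    · exact hlam0 i
    · rw [hlamupd]
      exact ⟨le_max_left _ _, max_le ((hlam0 i).1.trans (hlam0 i).2) (min_le_left _ _)⟩
  have hx1 : Tendsto (fun k => x (k + 1)) atTop (𝓝 xbar) := hx.comp (tendsto_add_atTop_nat 1)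
  have hgx : ∀ i, Tendsto (fun k => g i (x (k + 1))) atTop (𝓝 (g i xbar)) := fun i =>
    ((hg i).continuous.tendsto xbar).comp hx1
  let mu : ℕ → Fin n → ℝ := fun k i => ρ k * max 0 (lam k i / ρ k + g i (x (k + 1)))
  let nu : ℕ → Fin m → ℝ := fun k j => ρ k * (h j (x (k + 1)) + gam k j / ρ k)
  have hmu_nonneg : ∀ k i, 0 ≤ mu k i := fun k i =>
    mul_nonneg (hρpos k).le (le_max_left _ _)
  have hratio : ∀ i, g i xbar < 0 → Tendsto (fun k => lam k i / ρ k) atTop (𝓝 0) := by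
    intro i hi
    rcases halt with hρ | hmax
    · exact squeeze_zero (fun k => div_nonneg (hlam k i).1 (hρpos k).le)
        (fun k => div_le_div_of_nonneg_right (hlam k i).2 (hρpos k).le)
        (tendsto_const_nhds.div_atTop hρ)
    · have hneg : Tendsto (fun k => -(lam k i) / ρ k) atTop (𝓝 0) := by
        refine (hmax i).congr' ?_
        filter_upwards [(hgx i).eventually_lt_const (show g i xbar < g i xbar / 2 by linarith),
          (hmax i).eventually_const_lt (show g i xbar / 2 < 0 by linarith)] with k hk hk'
        exact max_eq_right ((lt_max_iff.1 hk').resolve_left hk.not_gt |>.le.trans' hk.le)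
      simpa [neg_div] using hneg.neg
  have hmu_zero : ∀ᶠ k in atTop, ∀ i, g i xbar ≠ 0 → mu k i = 0 := by
    refine eventually_all.2 fun i => ?_
    by_cases hi : g i xbar = 0
    · exact .of_forall fun k hk => absurd hi hk
    have hi' : g i xbar < 0 := lt_of_le_of_ne (hxbarfeas.1 i) hi
    have hsum := (hratio i hi').add (hgx i)
    rw [zero_add] at hsum
    filter_upwards [hsum.eventually_lt_const hi'] with k hk _
    simp only [mu, max_eq_left hk.le, mul_zero]
  have hgradL : ∀ k, gradient (L (ρ k) (lam k) (gam k)) (x (k + 1)) =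
      gradient f (x (k + 1)) + (∑ i, mu k i • gradient (g i) (x (k + 1)))
        + ∑ j, nu k j • gradient (h j) (x (k + 1)) := fun k => by
    rw [funext (hL (ρ k) (lam k) (gam k))]
    exact gradient_augmentedLagrangian (hf.differentiable two_ne_zero _)
      (fun i => (hg i).differentiable two_ne_zero _)
      (fun j => (hh j).differentiable two_ne_zero _) _ _ _
  have hstat : Tendsto (fun k => gradient (L (ρ k) (lam k) (gam k)) (x (k + 1))) atTop (𝓝 0) :=
    squeeze_zero_norm hgrad hε
  have hcont : ∀ {F : E → ℝ}, ContDiff ℝ 2 F →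
      Tendsto (fun k => gradient F (x (k + 1))) atTop (𝓝 (gradient F xbar)) := fun hF =>
    ((hF.continuous_gradient two_ne_zero).tendsto xbar).comp hx1
  have hsum_active : ∀ (c : Fin n → ℝ) (y : E), (∀ i, g i xbar ≠ 0 → c i = 0) →
      ∑ i : {i : Fin n // g i xbar = 0}, c i • gradient (g i) y = ∑ i, c i • gradient (g i) y := by
    intro c y hc
    rw [← Finset.sum_subtype (Finset.univ.filter fun i => g i xbar = 0) (by simp)
      fun i => c i • gradient (g i) y, Finset.sum_filter]
    refine Finset.sum_congr rfl fun i _ => ?_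
    split_ifs with hi <;> simp [hc i, hi]
  have hcomb : Tendsto (fun k =>
      ∑ s, Sum.elim (fun i : {i : Fin n // g i xbar = 0} => mu k i) (nu k) s •
        Sum.elim (fun i : {i : Fin n // g i xbar = 0} => gradient (g i) (x (k + 1)))
          (fun j => gradient (h j) (x (k + 1))) s) atTop (𝓝 (-gradient f xbar)) := by
    have hdiff := hstat.sub (hcont hf)
    rw [zero_sub] at hdiff
    refine hdiff.congr' ?_
    filter_upwards [hmu_zero] with k hk
    simp only [Fintype.sum_sum_type, Sum.elim_inl, Sum.elim_inr, hgradL,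
      hsum_active (mu k) (x (k + 1)) hk]
    abel
  obtain ⟨c, hc, hcw⟩ := hLICQ.exists_tendsto_coeff
    (by rintro (i | j)
        · exact hcont (hg i)
        · exact hcont (hh j)) hcomb
  obtain ⟨lams, hlams_active, hlams_zero⟩ : ∃ lams : Fin n → ℝ,
      (∀ i : {i : Fin n // g i xbar = 0}, lams i = c (.inl i)) ∧
        ∀ i, g i xbar ≠ 0 → lams i = 0 :=
    ⟨fun i => if hi : g i xbar = 0 then c (.inl ⟨i, hi⟩) else 0,
      fun i => dif_pos i.2, fun i hi => dif_neg hi⟩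
  refine ⟨lams, fun j => c (.inr j), fun i => ?_, fun i => ?_, ?_⟩
  · by_cases hi : g i xbar = 0
    · rw [hlams_active ⟨i, hi⟩]
      exact ge_of_tendsto' (hc (.inl ⟨i, hi⟩)) fun k => hmu_nonneg k i
    · exact (hlams_zero i hi).ge
  · by_cases hi : g i xbar = 0 <;> simp [hi, hlams_zero]
  · simp only [Fintype.sum_sum_type, Sum.elim_inl, Sum.elim_inr, ← hlams_active] at hcw
    rw [hsum_active lams xbar hlams_zero] at hcw
    rw [add_assoc, hcw, add_neg_cancel]
end
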